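/- Let V be a finite-dimensional (over K) left MU_v(2)-module. Then V is a weight module, i.e. V is the direct sum of its weight spaces V_{λ,ε}, and every weight (λ,ε) of V (i.e. every pair with V_{λ,ε} ≠ 0) satisfies λ = v^a or λ = −v^a for some a ∈ ℤ, and ε ∈ {0,1}. -/

import Mathlib

set_option synthInstance.maxHeartbeats 1000000
set_option maxHeartbeats 1000000

namespace MirabolicSL2

noncomputable section

/-- The base field `K = ℂ(v)`. -/
abbrev K : Type := RatFunc ℂ

/-- The variable `v ∈ ℂ(v)`. -/
def vv : K := RatFunc.X

/-- The quantum integer `[m] = (v^m - v^{-m})/(v - v⁻¹)`. -/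
def qn (m : ℤ) : K := (vv ^ m - vv ^ (-m)) / (vv - vv⁻¹)

/-- The five generators `e, f, k, k⁻¹, ℓ` of mirabolic quantum `sl₂`. -/
inductive G5 : Type | e | f | k | k' | l

open FreeAlgebra in
/-- The defining relations of mirabolic quantum `sl₂`. -/
inductive Rel : FreeAlgebra K G5 → FreeAlgebra K G5 → Prop
  | kk'  : Rel (ι K G5.k * ι K G5.k') 1
  | k'k  : Rel (ι K G5.k' * ι K G5.k) 1
  | kek' : Rel (ι K G5.k * ι K G5.e * ι K G5.k') ((vv ^ 2) • ι K G5.e)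
  | kfk' : Rel (ι K G5.k * ι K G5.f * ι K G5.k') ((vv ^ (-2 : ℤ)) • ι K G5.f)
  | effe : Rel (ι K G5.e * ι K G5.f - ι K G5.f * ι K G5.e)
      (((vv - vv⁻¹)⁻¹) • (ι K G5.k - ι K G5.k'))
  | ll   : Rel (ι K G5.l * ι K G5.l) (ι K G5.l)
  | kl   : Rel (ι K G5.k * ι K G5.l) (ι K G5.l * ι K G5.k)
  | lel  : Rel (ι K G5.l * ι K G5.e * ι K G5.l) (ι K G5.l * ι K G5.e)
  | lfl  : Rel (ι K G5.l * ι K G5.f * ι K G5.l) (ι K G5.f * ι K G5.l)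
  | serreE : Rel ((vv + vv⁻¹) • (ι K G5.e * ι K G5.l * ι K G5.e))
      (vv⁻¹ • (ι K G5.e * ι K G5.e * ι K G5.l) + vv • (ι K G5.l * (ι K G5.e * ι K G5.e)))
  | serreF : Rel ((vv + vv⁻¹) • (ι K G5.f * ι K G5.l * ι K G5.f))
      (vv⁻¹ • (ι K G5.l * (ι K G5.f * ι K G5.f)) + vv • (ι K G5.f * ι K G5.f * ι K G5.l))

/-- Mirabolic quantum `sl₂`: the unital `K`-algebra presented by the generators
`e, f, k, k⁻¹, ℓ` and the relations `Rel`. -/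
abbrev MU2 : Type := RingQuot Rel

/-- The generator `e` of `MU_v(2)`. -/
def Ee : MU2 := RingQuot.mkAlgHom K Rel (FreeAlgebra.ι K G5.e)
/-- The generator `f` of `MU_v(2)`. -/
def Ff : MU2 := RingQuot.mkAlgHom K Rel (FreeAlgebra.ι K G5.f)
/-- The generator `k` of `MU_v(2)`. -/
def Kk : MU2 := RingQuot.mkAlgHom K Rel (FreeAlgebra.ι K G5.k)
/-- The generator `k⁻¹` of `MU_v(2)`. -/
def Kk' : MU2 := RingQuot.mkAlgHom K Rel (FreeAlgebra.ι K G5.k')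
/-- The generator `ℓ` of `MU_v(2)`. -/
def Ll : MU2 := RingQuot.mkAlgHom K Rel (FreeAlgebra.ι K G5.l)

/-- The weight space `V_{λ,ε}` of a representation `ρ` of `MU_v(2)` on `V`:
the simultaneous eigenspace `{m | k·m = λ·m, ℓ·m = ε·m}`. -/
def wtSpace {V : Type} [AddCommGroup V] [Module K V]
    (ρ : MU2 →ₐ[K] Module.End K V) (lam eps : K) : Submodule K V :=
  LinearMap.ker (ρ Kk - lam • (1 : Module.End K V)) ⊓
    LinearMap.ker (ρ Ll - eps • (1 : Module.End K V))

section QuantumTriple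

variable {F V : Type*} [Field F] [AddCommGroup V] [Module F V]

/-- The span of the eigenvectors of `k` with eigenvalue in `T`. -/
def eigenspan (k : Module.End F V) (T : Set F) : Submodule F V :=
  Submodule.span F {x | ∃ μ ∈ T, k x = μ • x}

theorem mem_eigenspan {k : Module.End F V} {T : Set F} {μ : F} (hμ : μ ∈ T) {x : V}
    (hx : k x = μ • x) : x ∈ eigenspan k T :=
  Submodule.subset_span ⟨μ, hμ, hx⟩

theorem eigenspan_mono (k : Module.End F V) {S T : Set F} (h : S ⊆ T) :
    eigenspan k S ≤ eigenspan k T :=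
  Submodule.span_mono fun _ ⟨μ, hμ, hx⟩ => ⟨μ, h hμ, hx⟩

theorem map_mem_eigenspan {k : Module.End F V} {T : Set F} {x : V} (hx : x ∈ eigenspan k T) :
    k x ∈ eigenspan k T := by
  induction hx using Submodule.span_induction with
  | mem x hx =>
    obtain ⟨μ, hμ, h⟩ := hx
    rw [h]
    exact Submodule.smul_mem _ _ (mem_eigenspan hμ h)
  | zero => simp
  | add x y _ _ hx hy => rw [map_add]; exact add_mem hx hy
  | smul a x _ hx => rw [map_smul]; exact Submodule.smul_mem _ _ hx

theorem exists_mem_eigenspan_apply_sub_smul_eq {k : Module.End F V} {T : Set F} {ν : F}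
    (hν : ν ∉ T) {y : V} (hy : y ∈ eigenspan k T) :
    ∃ z ∈ eigenspan k T, k z - ν • z = y := by
  induction hy using Submodule.span_induction with
  | mem y hy =>
    obtain ⟨μ, hμ, h⟩ := hy
    have hne : μ - ν ≠ 0 := sub_ne_zero.2 fun h => hν (h ▸ hμ)
    refine ⟨(μ - ν)⁻¹ • y, Submodule.smul_mem _ _ (mem_eigenspan hμ h), ?_⟩
    rw [map_smul, h, smul_comm ν, ← smul_sub, ← sub_smul, inv_smul_smul₀ hne]
  | zero => exact ⟨0, zero_mem _, by simp⟩
  | add x y _ _ hx hy =>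
    obtain ⟨a, ha, rfl⟩ := hx
    obtain ⟨b, hb, rfl⟩ := hy
    exact ⟨a + b, add_mem ha hb, by rw [map_add, smul_add]; abel⟩
  | smul c x _ hx =>
    obtain ⟨a, ha, rfl⟩ := hx
    exact ⟨c • a, Submodule.smul_mem _ _ ha, by rw [map_smul, smul_sub, smul_comm]⟩

theorem mem_eigenspan_insert {k : Module.End F V} {T : Set F} {ν : F} (hν : ν ∉ T) {x : V}
    (hx : k x - ν • x ∈ eigenspan k T) : x ∈ eigenspan k (insert ν T) := by
  obtain ⟨z, hz, h⟩ := exists_mem_eigenspan_apply_sub_smul_eq hν hx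
  rw [← sub_add_cancel x z]
  refine add_mem (mem_eigenspan (Set.mem_insert _ _) ?_)
    (eigenspan_mono k (Set.subset_insert _ _) hz)
  rw [map_sub, smul_sub, sub_eq_sub_iff_sub_eq_sub]
  exact h.symm

theorem exists_add_of_mem_eigenspan_insert {k : Module.End F V} {T : Set F} {ν : F} {x : V}
    (hx : x ∈ eigenspan k (insert ν T)) :
    ∃ y, k y = ν • y ∧ ∃ z ∈ eigenspan k T, y + z = x := by
  induction hx using Submodule.span_induction with
  | mem x hx =>
    obtain ⟨μ, rfl | hμ, h⟩ := hx
    · exact ⟨x, h, 0, zero_mem _, add_zero x⟩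
    · exact ⟨0, by simp, x, mem_eigenspan hμ h, zero_add x⟩
  | zero => exact ⟨0, by simp, 0, zero_mem _, add_zero 0⟩
  | add x y _ _ hx hy =>
    obtain ⟨a, ha, b, hb, rfl⟩ := hx
    obtain ⟨c, hc, d, hd, rfl⟩ := hy
    exact ⟨a + c, by rw [map_add, ha, hc, smul_add], b + d, add_mem hb hd, by abel⟩
  | smul t x _ hx =>
    obtain ⟨a, ha, b, hb, rfl⟩ := hx
    exact ⟨t • a, by rw [map_smul, ha, smul_comm], t • b, Submodule.smul_mem _ _ hb,
      (smul_add _ _ _).symm⟩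

theorem exists_finset_mem_eigenspan {k : Module.End F V} {T : Set F} {x : V}
    (hx : x ∈ eigenspan k T) : ∃ s : Finset F, ↑s ⊆ T ∧ x ∈ eigenspan k (s : Set F) := by
  classical
  induction hx using Submodule.span_induction with
  | mem x hx =>
    obtain ⟨μ, hμ, h⟩ := hx
    exact ⟨{μ}, by simpa using hμ, mem_eigenspan (by simp) h⟩
  | zero => exact ⟨∅, by simp, zero_mem _⟩
  | add x y _ _ hx hy =>
    obtain ⟨s, hs, hxs⟩ := hx
    obtain ⟨t, ht, hyt⟩ := hy
    refine ⟨s ∪ t, by simp [hs, ht], add_mem (eigenspan_mono k ?_ hxs) (eigenspan_mono k ?_ hyt)⟩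
      <;> simp
  | smul c x _ hx =>
    obtain ⟨s, hs, hxs⟩ := hx
    exact ⟨s, hs, Submodule.smul_mem _ _ hxs⟩

/-- An operator that is rescaled by an infinite order scalar under conjugation is nilpotent. -/
theorem isNilpotent_of_conj_eq_smul [FiniteDimensional F V] {k k' e : Module.End F V} {c : F}
    (hc : Function.Injective fun n : ℕ => c ^ n) (hk : k * k' = 1) (he : k * e = c • (e * k)) :
    IsNilpotent e := by
  by_contra hne
  have hpow : ∀ n : ℕ, k * e ^ n = c ^ n • (e ^ n * k) := by
    intro n
    induction n with
    | zero => simp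
    | succ n ih =>
      rw [pow_succ, ← mul_assoc, ih, smul_mul_assoc, mul_assoc, he, mul_smul_comm, smul_smul,
        mul_assoc, pow_succ]
  have hli := Module.End.eigenvectors_linearIndependent'
    (LinearMap.mulLeft F k ∘ₗ LinearMap.mulRight F k') (fun n : ℕ => c ^ n) hc (fun n => e ^ n)
    fun n => by
      refine ⟨Module.End.mem_eigenspace_iff.2 ?_, fun h => hne ⟨n, h⟩⟩
      simp only [LinearMap.comp_apply, LinearMap.mulLeft_apply, LinearMap.mulRight_apply]
      rw [← mul_assoc, hpow, smul_mul_assoc, mul_assoc, hk, mul_one]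
  exact Infinite.not_finite hli.finite

theorem iSupIndep_inf_eigenspace {a b : Module.End F V} (hab : Commute a b) :
    iSupIndep fun p : F × F => a.eigenspace p.1 ⊓ b.eigenspace p.2 := by
  have h := Module.End.independent_iInf_maxGenEigenspace_of_forall_mapsTo ![a, b] fun i j φ =>
    Module.End.mapsTo_maxGenEigenspace_of_comm (by
      fin_cases i <;> fin_cases j <;> simp [hab, hab.symm]) φ
  have hinj : Function.Injective fun p : F × F => ![p.1, p.2] := fun p r hpr =>
    Prod.ext (congrFun hpr 0) (congrFun hpr 1)
  refine (h.comp hinj).mono fun p => le_iInf fun i => ?_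
  fin_cases i
  · exact inf_le_left.trans Module.End.eigenspace_le_maxGenEigenspace
  · exact inf_le_right.trans Module.End.eigenspace_le_maxGenEigenspace

/-- Operators `e, f, k, k'` satisfying the defining relations of quantum `sl₂`, where the scalar
`d` plays the role of `(q - q⁻¹)⁻¹`. -/
structure IsQuantumTriple (q d : F) (e f k k' : Module.End F V) : Prop where
  k_mul_k' : k * k' = 1
  k'_mul_k : k' * k = 1
  k_mul_e : k * e = q ^ 2 • (e * k)
  k_mul_f : k * f = (q ^ 2)⁻¹ • (f * k)
  e_mul_f : e * f - f * e = d • (k - k')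
  d_ne_zero : d ≠ 0

theorem injective_pow_of_pow_ne_one {c : F} (hc0 : c ≠ 0) (hc : ∀ n : ℕ, c ^ (n + 1) ≠ 1) :
    Function.Injective fun n : ℕ => c ^ n := by
  intro m n h
  by_contra hmn
  wlog hlt : m < n generalizing m n
  · exact this h.symm (Ne.symm hmn) (by omega)
  obtain ⟨t, rfl⟩ := Nat.exists_eq_add_of_lt hlt
  refine hc t ?_
  have h' : c ^ m * c ^ (t + 1) = c ^ m * 1 := by
    rw [mul_one, ← pow_add]
    exact h.symm
  exact mul_left_cancel₀ (pow_ne_zero m hc0) h'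

theorem geom_sum_ne_zero_of_pow_ne_one {c : F} (hc : ∀ n : ℕ, c ^ (n + 1) ≠ 1) (n : ℕ) :
    ∑ i ∈ Finset.range (n + 1), c ^ i ≠ 0 := by
  intro h
  have h' := geom_sum_mul c (n + 1)
  rw [h, zero_mul] at h'
  exact hc n (sub_eq_zero.1 h'.symm)

theorem geom_sum_inv_mul_pow {c : F} (hc0 : c ≠ 0) (n : ℕ) :
    c ^ n * ∑ i ∈ Finset.range (n + 1), c⁻¹ ^ i = ∑ i ∈ Finset.range (n + 1), c ^ i := by
  induction n with
  | zero => simp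
  | succ n ih =>
    rw [geom_sum_succ (x := c), ← ih, Finset.sum_range_succ, mul_add, inv_pow,
      mul_inv_cancel₀ (pow_ne_zero _ hc0), pow_succ']
    ring

theorem zpow_ne_one_of_pow_ne_one {c : F} (hc : ∀ n : ℕ, c ^ (n + 1) ≠ 1) {n : ℤ} (hn : n ≠ 0) :
    c ^ n ≠ 1 := by
  intro h
  obtain ⟨m, hm⟩ := Nat.exists_eq_succ_of_ne_zero (Int.natAbs_ne_zero.2 hn)
  refine hc m ?_
  rw [← Nat.succ_eq_add_one, ← hm, ← zpow_natCast]
  rcases Int.natAbs_eq n with h' | h'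
  · rw [← h', h]
  · rw [show ((n.natAbs : ℕ) : ℤ) = -n by omega, zpow_neg, h, inv_one]

theorem eq_of_zpow_eq_of_pow_ne_one {c : F} (hc0 : c ≠ 0) (hc : ∀ n : ℕ, c ^ (n + 1) ≠ 1)
    {m n : ℤ} (h : c ^ m = c ^ n) : m = n := by
  by_contra hmn
  refine zpow_ne_one_of_pow_ne_one hc (sub_ne_zero.2 hmn) ?_
  rw [zpow_sub₀ hc0, h, div_self (zpow_ne_zero n hc0)]

namespace IsQuantumTriple

variable {q d : F} {e f k k' : Module.End F V}

theorem apply_k_e (h : IsQuantumTriple q d e f k k') (x : V) : k (e x) = q ^ 2 • e (k x) :=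
  DFunLike.congr_fun h.k_mul_e x

theorem apply_k_f (h : IsQuantumTriple q d e f k k') (x : V) : k (f x) = (q ^ 2)⁻¹ • f (k x) :=
  DFunLike.congr_fun h.k_mul_f x

theorem apply_k_k' (h : IsQuantumTriple q d e f k k') (x : V) : k (k' x) = x :=
  DFunLike.congr_fun h.k_mul_k' x

theorem apply_k'_k (h : IsQuantumTriple q d e f k k') (x : V) : k' (k x) = x :=
  DFunLike.congr_fun h.k'_mul_k x

theorem apply_e_f (h : IsQuantumTriple q d e f k k') (x : V) :
    e (f x) = f (e x) + d • (k x - k' x) := by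
  rw [← sub_eq_iff_eq_add']
  exact DFunLike.congr_fun h.e_mul_f x

theorem apply_k'_f (h : IsQuantumTriple q d e f k k') (hq0 : q ≠ 0) (x : V) :
    k' (f x) = q ^ 2 • f (k' x) := by
  have h1 := h.apply_k_f (k' x)
  rw [h.apply_k_k'] at h1
  have h2 := congrArg k' h1
  rw [h.apply_k'_k, map_smul] at h2
  rw [h2, smul_inv_smul₀ (pow_ne_zero 2 hq0)]

theorem apply_k_f_pow (h : IsQuantumTriple q d e f k k') (n : ℕ) (x : V) :
    k ((f ^ n) x) = (q ^ 2)⁻¹ ^ n • (f ^ n) (k x) := by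
  induction n generalizing x with
  | zero => simp
  | succ n ih =>
    rw [pow_succ, Module.End.mul_apply, ih, h.apply_k_f, map_smul, smul_smul,
      pow_succ (q ^ 2)⁻¹, Module.End.mul_apply]

theorem apply_k'_f_pow (h : IsQuantumTriple q d e f k k') (hq0 : q ≠ 0) (n : ℕ) (x : V) :
    k' ((f ^ n) x) = (q ^ 2) ^ n • (f ^ n) (k' x) := by
  induction n generalizing x with
  | zero => simp
  | succ n ih =>
    rw [pow_succ, Module.End.mul_apply, ih, h.apply_k'_f hq0, map_smul, smul_smul, pow_succ (q ^ 2),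
      Module.End.mul_apply]

theorem apply_e_f_pow (h : IsQuantumTriple q d e f k k') (hq0 : q ≠ 0) {x : V} (hx : e x = 0)
    (n : ℕ) :
    e ((f ^ (n + 1)) x) = d • ((∑ i ∈ Finset.range (n + 1), (q ^ 2)⁻¹ ^ i) • (f ^ n) (k x) -
      (∑ i ∈ Finset.range (n + 1), (q ^ 2) ^ i) • (f ^ n) (k' x)) := by
  induction n with
  | zero => simp [h.apply_e_f, hx]
  | succ n ih =>
    have hf : ∀ y, f ((f ^ n) y) = (f ^ (n + 1)) y := fun y => by
      rw [pow_succ', Module.End.mul_apply]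
    rw [pow_succ', Module.End.mul_apply, h.apply_e_f, ih, h.apply_k_f_pow, h.apply_k'_f_pow hq0,
      Finset.sum_range_succ _ (n + 1), Finset.sum_range_succ _ (n + 1), map_smul, map_sub,
      map_smul, map_smul, hf, hf]
    module

theorem f_pow_apply_eq_zero (h : IsQuantumTriple q d e f k k') (hq0 : q ≠ 0)
    (hq : ∀ n : ℕ, (q ^ 2) ^ (n + 1) ≠ 1) {x : V} (hx : e x = 0) {n : ℕ}
    (hn : (f ^ (n + 1)) x = 0) : (f ^ n) (k (k x) - (q ^ 2) ^ n • x) = 0 := by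
  have hp0 : q ^ 2 ≠ 0 := pow_ne_zero 2 hq0
  have hp : ∀ n : ℕ, (q ^ 2)⁻¹ ^ (n + 1) ≠ 1 := fun n => by
    rw [inv_pow, Ne, inv_eq_one]
    exact hq n
  have hkx : e (k x) = 0 := by
    have h1 := h.apply_k_e x
    rw [hx, map_zero] at h1
    exact (smul_eq_zero.1 h1.symm).resolve_left hp0
  have hfk : (f ^ (n + 1)) (k x) = 0 := by
    have h1 := h.apply_k_f_pow (n + 1) x
    rw [hn, map_zero] at h1
    exact (smul_eq_zero.1 h1.symm).resolve_left (pow_ne_zero _ (inv_ne_zero hp0))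
  have key := h.apply_e_f_pow hq0 hkx n
  rw [hfk, map_zero, ← geom_sum_inv_mul_pow hp0, h.apply_k'_k, mul_comm, mul_smul, ← smul_sub,
    smul_smul] at key
  rw [map_sub, map_smul]
  exact (smul_eq_zero.1 key.symm).resolve_left
    (mul_ne_zero h.d_ne_zero (geom_sum_ne_zero_of_pow_ne_one hp n))

theorem mem_eigenspan_of_f_pow_eq_zero [CharZero F] (h : IsQuantumTriple q d e f k k')
    (hq0 : q ≠ 0) (hq : ∀ n : ℕ, (q ^ 2) ^ (n + 1) ≠ 1) {n : ℕ} {x : V} (hx : e x = 0)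
    (hn : (f ^ n) x = 0) : x ∈ eigenspan k {μ | ∃ j < n, μ ^ 2 = (q ^ 2) ^ j} := by
  have hp0 : q ^ 2 ≠ 0 := pow_ne_zero 2 hq0
  have hker : ∀ {x}, e x = 0 → e (k x) = 0 := fun {x} hx => by
    have h1 := h.apply_k_e x
    rw [hx, map_zero] at h1
    exact (smul_eq_zero.1 h1.symm).resolve_left hp0
  induction n generalizing x with
  | zero =>
    rw [pow_zero, Module.End.one_apply] at hn
    rw [hn]
    exact zero_mem _
  | succ n ih =>
    have hmem := ih (x := k (k x) - (q ^ 2) ^ n • x)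
      (by rw [map_sub, map_smul, hx, hker (hker hx), smul_zero, sub_zero])
      (h.f_pow_apply_eq_zero hq0 hq hx hn)
    have hnot : ∀ {ν : F}, ν ^ 2 = (q ^ 2) ^ n → ν ∉ {μ | ∃ j < n, μ ^ 2 = (q ^ 2) ^ j} := by
      rintro ν hν ⟨j, hj, hνj⟩
      exact hj.ne (injective_pow_of_pow_ne_one hp0 hq (hνj.symm.trans hν))
    have hsq : (q ^ n) ^ 2 = (q ^ 2) ^ n := by rw [← pow_mul, ← pow_mul, mul_comm]
    have hsq' : (-q ^ n) ^ 2 = (q ^ 2) ^ n := by rw [neg_sq, hsq]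
    have h1 : k x - (-q ^ n) • x ∈ _ := mem_eigenspan_insert (k := k) (hnot hsq) (by
      convert hmem using 1
      rw [← hsq, map_sub, map_smul]
      module)
    have h2 := mem_eigenspan_insert (k := k) (by
      rintro (h3 | h3)
      · exact pow_ne_zero n hq0 (self_eq_neg.1 h3.symm)
      · exact hnot hsq' h3) h1
    refine eigenspan_mono k ?_ h2
    rintro μ (rfl | rfl | ⟨j, hj, hμ⟩)
    · exact ⟨n, n.lt_succ_self, hsq'⟩
    · exact ⟨n, n.lt_succ_self, hsq⟩
    · exact ⟨j, hj.trans n.lt_succ_self, hμ⟩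

theorem k'_apply_of_k_apply (h : IsQuantumTriple q d e f k k') {μ : F} {y : V}
    (hy : k y = μ • y) (hμ : μ ≠ 0) : k' y = μ⁻¹ • y := by
  have h1 := congrArg k' hy
  rw [h.apply_k'_k, map_smul] at h1
  nth_rw 2 [h1]
  rw [inv_smul_smul₀ hμ]

theorem k_e_pow_apply (h : IsQuantumTriple q d e f k k') {μ : F} {y : V}
    (hy : k y = μ • y) (i : ℕ) : k ((e ^ i) y) = (μ * (q ^ 2) ^ i) • (e ^ i) y := by
  induction i with
  | zero => simpa using hy
  | succ i ih =>
    rw [pow_succ', Module.End.mul_apply, h.apply_k_e, ih, map_smul, smul_smul]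
    congr 1
    ring

theorem f_e_pow_apply (h : IsQuantumTriple q d e f k k') (hq0 : q ≠ 0) {μ : F} {y : V}
    (hμ : μ ≠ 0) (hy : k y = μ • y) (hef : e (f y) = 0) (i : ℕ) :
    f ((e ^ (i + 1)) y) = -(d * (μ * (∑ j ∈ Finset.range (i + 1), (q ^ 2) ^ j) -
      μ⁻¹ * ∑ j ∈ Finset.range (i + 1), (q ^ 2)⁻¹ ^ j)) • (e ^ i) y := by
  have hp0 : q ^ 2 ≠ 0 := pow_ne_zero 2 hq0
  have step : ∀ i : ℕ, f ((e ^ (i + 1)) y) = e (f ((e ^ i) y)) -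
      (d * (μ * (q ^ 2) ^ i - μ⁻¹ * (q ^ 2)⁻¹ ^ i)) • (e ^ i) y := by
    intro i
    have h1 := h.k_e_pow_apply hy i
    have h2 := h.k'_apply_of_k_apply h1 (mul_ne_zero hμ (pow_ne_zero i hp0))
    rw [h.apply_e_f, h1, h2, pow_succ', Module.End.mul_apply, mul_inv, inv_pow]
    module
  induction i with
  | zero =>
    rw [step 0]
    simp [hef]
  | succ i ih =>
    rw [step (i + 1), ih, map_smul, ← Module.End.mul_apply, ← pow_succ',
      Finset.sum_range_succ _ (i + 1), Finset.sum_range_succ _ (i + 1)]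
    module

theorem eq_zero_of_e_f_apply_eq_zero (h : IsQuantumTriple q d e f k k') (hq0 : q ≠ 0)
    (hq : ∀ n : ℕ, (q ^ 2) ^ (n + 1) ≠ 1) (he : IsNilpotent e) {μ : F} (hμ : μ ≠ 0)
    (hμq : ∀ i : ℕ, μ ^ 2 * (q ^ 2) ^ i ≠ 1) {y : V} (hy : k y = μ • y) (hef : e (f y) = 0) :
    y = 0 := by
  have hp0 : q ^ 2 ≠ 0 := pow_ne_zero 2 hq0
  obtain ⟨N, hN⟩ := he
  have hNy : (e ^ N) y = 0 := by rw [hN, LinearMap.zero_apply]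
  clear hN
  induction N with
  | zero => simpa using hNy
  | succ i ih =>
    refine ih ?_
    have key := h.f_e_pow_apply hq0 hμ hy hef i
    rw [hNy, map_zero] at key
    refine (smul_eq_zero.1 key.symm).resolve_left (neg_ne_zero.2 (mul_ne_zero h.d_ne_zero ?_))
    rw [← geom_sum_inv_mul_pow hp0, ← mul_assoc, ← sub_mul]
    refine mul_ne_zero (fun h0 => hμq i ?_) ?_
    · rw [pow_two μ, mul_assoc, sub_eq_zero.1 h0, mul_inv_cancel₀ hμ]
    · refine geom_sum_ne_zero_of_pow_ne_one (fun n => ?_) i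
      rw [inv_pow, Ne, inv_eq_one]
      exact hq n

theorem exists_e_apply_eq [FiniteDimensional F V] (h : IsQuantumTriple q d e f k k')
    (hq0 : q ≠ 0) (hq : ∀ n : ℕ, (q ^ 2) ^ (n + 1) ≠ 1) (he : IsNilpotent e) {μ : F} (hμ : μ ≠ 0)
    (hμq : ∀ i : ℕ, μ ^ 2 * (q ^ 2) ^ i ≠ 1) {y : V} (hy : k y = μ • y) :
    ∃ x, k x = ((q ^ 2)⁻¹ * μ) • x ∧ e x = y := by
  have hp0 : q ^ 2 ≠ 0 := pow_ne_zero 2 hq0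
  have hf : ∀ {z}, k z = μ • z → k (f z) = ((q ^ 2)⁻¹ * μ) • f z := fun {z} hz => by
    rw [h.apply_k_f, hz, map_smul, smul_smul]
  have hmap : ∀ z ∈ k.eigenspace μ, (e * f) z ∈ k.eigenspace μ := fun z hz => by
    rw [Module.End.mem_eigenspace_iff] at hz ⊢
    rw [Module.End.mul_apply, h.apply_k_e, hf hz, map_smul, smul_smul, mul_inv_cancel_left₀ hp0]
  have hinj : Function.Injective ((e * f).restrict hmap) := by
    refine (injective_iff_map_eq_zero _).2 fun z hz => Subtype.ext ?_
    exact h.eq_zero_of_e_f_apply_eq_zero hq0 hq he hμ hμq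
      (Module.End.mem_eigenspace_iff.1 z.2) (congrArg Subtype.val hz)
  obtain ⟨z, hz⟩ := LinearMap.injective_iff_surjective.1 hinj
    ⟨y, Module.End.mem_eigenspace_iff.2 hy⟩
  exact ⟨f z, hf (Module.End.mem_eigenspace_iff.1 z.2), congrArg Subtype.val hz⟩

theorem mem_eigenspan_of_e_apply_mem [CharZero F] [FiniteDimensional F V]
    (h : IsQuantumTriple q d e f k k') (hq0 : q ≠ 0) (hq : ∀ n : ℕ, (q ^ 2) ^ (n + 1) ≠ 1)
    (he : IsNilpotent e) (hf : IsNilpotent f) (s : Finset F)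
    (hs : ∀ μ ∈ s, ∃ b : ℤ, μ ^ 2 = (q ^ 2) ^ b) {x : V} (hx : e x ∈ eigenspan k (s : Set F)) :
    x ∈ eigenspan k ({μ | ∃ n : ℕ, μ ^ 2 = (q ^ 2) ^ n} ∪ {μ | q ^ 2 * μ ∈ s}) := by
  classical
  have hp0 : q ^ 2 ≠ 0 := pow_ne_zero 2 hq0
  induction s using Finset.induction_on generalizing x with
  | empty =>
    obtain ⟨N, hN⟩ := hf
    have hx0 : e x = 0 := by simpa [eigenspan] using hx
    refine eigenspan_mono k ?_
      (h.mem_eigenspan_of_f_pow_eq_zero hq0 hq hx0 (n := N) (by rw [hN, LinearMap.zero_apply]))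
    rintro μ ⟨j, -, hj⟩
    exact Or.inl ⟨j, hj⟩
  | insert μ s hμs ih =>
    replace ih := @ih fun ν hν => hs ν (Finset.mem_insert_of_mem hν)
    obtain ⟨b, hb⟩ := hs μ (Finset.mem_insert_self μ s)
    have hμ : μ ≠ 0 := fun h0 => zpow_ne_zero b hp0 (by rw [← hb, h0, zero_pow two_ne_zero])
    rw [Finset.coe_insert] at hx
    obtain ⟨y, hy, z, hz, hyz⟩ := exists_add_of_mem_eigenspan_insert hx
    have hmono : ({ν | ∃ n : ℕ, ν ^ 2 = (q ^ 2) ^ n} ∪ {ν | q ^ 2 * ν ∈ s} : Set F) ⊆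
        {ν | ∃ n : ℕ, ν ^ 2 = (q ^ 2) ^ n} ∪ {ν | q ^ 2 * ν ∈ insert μ s} :=
      Set.union_subset_union_right _ fun ν hν => Finset.mem_insert_of_mem hν
    have hmem : (q ^ 2)⁻¹ * μ ∈ ({ν | ∃ n : ℕ, ν ^ 2 = (q ^ 2) ^ n} ∪
        {ν | q ^ 2 * ν ∈ insert μ s} : Set F) := by
      right
      rw [Set.mem_ofPred_eq, mul_inv_cancel_left₀ hp0]
      exact Finset.mem_insert_self μ s
    rcases lt_or_ge 0 b with hpos | hneg
    · obtain ⟨x', hkx', hex'⟩ := h.exists_e_apply_eq hq0 hq he hμ (fun i => by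
        rw [hb, ← zpow_natCast (q ^ 2), ← zpow_add₀ hp0]
        exact zpow_ne_one_of_pow_ne_one hq (by omega)) hy
      rw [← sub_add_cancel x x']
      refine add_mem (eigenspan_mono k hmono (ih ?_)) (mem_eigenspan hmem hkx')
      rwa [map_sub, hex', ← hyz, add_sub_cancel_left]
    · refine eigenspan_mono k (Set.insert_subset hmem hmono) (mem_eigenspan_insert ?_ (ih ?_))
      · rintro (⟨n, hn⟩ | hμ')
        · have hn' : (q ^ 2) ^ (-2 + b) = (q ^ 2) ^ (n : ℤ) := by
            rw [zpow_add₀ hp0, zpow_neg, zpow_ofNat, zpow_natCast, ← hn, mul_pow, hb, inv_pow]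
          have := eq_of_zpow_eq_of_pow_ne_one hp0 hq hn'
          omega
        · rw [Set.mem_ofPred_eq, mul_inv_cancel_left₀ hp0] at hμ'
          exact hμs hμ'
      · have hek : e (k x) = (q ^ 2)⁻¹ • k (e x) := by
          rw [h.apply_k_e, inv_smul_smul₀ hp0]
        have : e (k x - ((q ^ 2)⁻¹ * μ) • x) = (q ^ 2)⁻¹ • (k z - μ • z) := by
          rw [map_sub, map_smul, hek, ← hyz, map_add, hy]
          module
        rw [this]
        exact Submodule.smul_mem _ _ (sub_mem (map_mem_eigenspan hz) (Submodule.smul_mem _ _ hz))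

theorem eigenspan_eq_top [CharZero F] [FiniteDimensional F V]
    (h : IsQuantumTriple q d e f k k') (hq0 : q ≠ 0) (hq : ∀ n : ℕ, (q ^ 2) ^ (n + 1) ≠ 1) :
    eigenspan k {μ | ∃ b : ℤ, μ ^ 2 = (q ^ 2) ^ b} = ⊤ := by
  have hp0 : q ^ 2 ≠ 0 := pow_ne_zero 2 hq0
  have he : IsNilpotent e :=
    isNilpotent_of_conj_eq_smul (injective_pow_of_pow_ne_one hp0 hq) h.k_mul_k' h.k_mul_e
  have hf : IsNilpotent f :=
    isNilpotent_of_conj_eq_smul (injective_pow_of_pow_ne_one (inv_ne_zero hp0) fun n => by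
      rw [inv_pow, Ne, inv_eq_one]
      exact hq n) h.k_mul_k' h.k_mul_f
  suffices key : ∀ (m : ℕ) (x : V), (e ^ m) x = 0 →
      x ∈ eigenspan k {μ | ∃ b : ℤ, μ ^ 2 = (q ^ 2) ^ b} by
    obtain ⟨N, hN⟩ := he
    exact eq_top_iff.2 fun x _ => key N x (by rw [hN, LinearMap.zero_apply])
  intro m
  induction m with
  | zero =>
    intro x hx
    rw [pow_zero, Module.End.one_apply] at hx
    rw [hx]
    exact zero_mem _
  | succ m ih =>
    intro x hx
    rw [pow_succ, Module.End.mul_apply] at hx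
    obtain ⟨s, hs, hxs⟩ := exists_finset_mem_eigenspan (ih (e x) hx)
    refine eigenspan_mono k ?_ (h.mem_eigenspan_of_e_apply_mem hq0 hq he hf s hs hxs)
    rintro μ (⟨n, hn⟩ | hμ)
    · exact ⟨n, by rw [hn, zpow_natCast]⟩
    · obtain ⟨b, hb⟩ := hs hμ
      refine ⟨b - 2, ?_⟩
      rw [zpow_sub₀ hp0, ← hb, mul_pow, zpow_ofNat, mul_div_cancel_left₀ _ (pow_ne_zero 2 hp0)]

theorem eigenvalue_sq [CharZero F] [FiniteDimensional F V]
    (h : IsQuantumTriple q d e f k k') (hq0 : q ≠ 0) (hq : ∀ n : ℕ, (q ^ 2) ^ (n + 1) ≠ 1)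
    {μ : F} {x : V} (hx : k x = μ • x) (hx0 : x ≠ 0) : ∃ b : ℤ, μ ^ 2 = (q ^ 2) ^ b := by
  by_contra hμ
  have hsurj : Function.Surjective (k - μ • (1 : Module.End F V)) := fun y => by
    obtain ⟨z, -, hz⟩ := exists_mem_eigenspan_apply_sub_smul_eq (k := k) (y := y) hμ
      (by rw [h.eigenspan_eq_top hq0 hq]; trivial)
    exact ⟨z, by simpa using hz⟩
  refine hx0 (LinearMap.injective_iff_surjective.2 hsurj ?_)
  simp [hx]

end IsQuantumTriple

end QuantumTriple

theorem vv_ne_zero : vv ≠ 0 := RatFunc.X_ne_zero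

theorem vv_sq_pow_ne_one (n : ℕ) : (vv ^ 2) ^ (n + 1) ≠ 1 := by
  rw [← pow_mul, vv, ← RatFunc.algebraMap_X, ← map_pow,
    ← map_one (algebraMap (Polynomial ℂ) (RatFunc ℂ))]
  intro h
  have h' := congrArg Polynomial.natDegree (RatFunc.algebraMap_injective ℂ h)
  rw [Polynomial.natDegree_X_pow, Polynomial.natDegree_one] at h'
  omega

theorem vv_sub_inv_ne_zero : vv - vv⁻¹ ≠ 0 := by
  intro h
  refine vv_sq_pow_ne_one 0 ?_
  rw [zero_add, pow_one, pow_two]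
  nth_rw 2 [sub_eq_zero.1 h]
  exact mul_inv_cancel₀ vv_ne_zero

theorem Kk_mul_Kk' : Kk * Kk' = 1 := by
  simpa [Kk, Kk'] using RingQuot.mkAlgHom_rel K Rel.kk'

theorem Kk'_mul_Kk : Kk' * Kk = 1 := by
  simpa [Kk, Kk'] using RingQuot.mkAlgHom_rel K Rel.k'k

theorem Kk_mul_Ee_mul_Kk' : Kk * Ee * Kk' = vv ^ 2 • Ee := by
  simpa [Kk, Kk', Ee] using RingQuot.mkAlgHom_rel K Rel.kek'

theorem Kk_mul_Ff_mul_Kk' : Kk * Ff * Kk' = vv ^ (-2 : ℤ) • Ff := by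
  simpa [Kk, Kk', Ff] using RingQuot.mkAlgHom_rel K Rel.kfk'

theorem Ee_mul_Ff_sub : Ee * Ff - Ff * Ee = (vv - vv⁻¹)⁻¹ • (Kk - Kk') := by
  simpa [Kk, Kk', Ee, Ff] using RingQuot.mkAlgHom_rel K Rel.effe

theorem Ll_mul_Ll : Ll * Ll = Ll := by
  simpa [Ll] using RingQuot.mkAlgHom_rel K Rel.ll

theorem Kk_mul_Ll : Kk * Ll = Ll * Kk := by
  simpa [Kk, Ll] using RingQuot.mkAlgHom_rel K Rel.kl

theorem isQuantumTriple_of_rep {V : Type*} [AddCommGroup V] [Module K V]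
    (ρ : MU2 →ₐ[K] Module.End K V) :
    IsQuantumTriple vv (vv - vv⁻¹)⁻¹ (ρ Ee) (ρ Ff) (ρ Kk) (ρ Kk') where
  k_mul_k' := by rw [← map_mul, Kk_mul_Kk', map_one]
  k'_mul_k := by rw [← map_mul, Kk'_mul_Kk, map_one]
  k_mul_e := by
    rw [← map_mul, ← map_mul, ← map_smul, ← smul_mul_assoc, ← Kk_mul_Ee_mul_Kk', mul_assoc _ Kk',
      Kk'_mul_Kk, mul_one]
  k_mul_f := by
    have hinv : (vv ^ 2)⁻¹ = vv ^ (-2 : ℤ) := by rw [zpow_neg, zpow_ofNat]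
    rw [← map_mul, ← map_mul, ← map_smul, ← smul_mul_assoc, hinv, ← Kk_mul_Ff_mul_Kk',
      mul_assoc _ Kk', Kk'_mul_Kk, mul_one]
  e_mul_f := by
    rw [← map_mul, ← map_mul, ← map_sub, ← map_sub, ← map_smul, Ee_mul_Ff_sub]
  d_ne_zero := inv_ne_zero vv_sub_inv_ne_zero

/-- Proposition 5.2: a finite dimensional `MU_v(2)`-module is the direct sum of its
weight spaces, and every weight `(λ, ε)` satisfies `λ = ±v^a` for some `a ∈ ℤ` and
`ε ∈ {0, 1}`. -/
theorem finite_dimensional_weight_module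
    (V : Type) [AddCommGroup V] [Module K V] [FiniteDimensional K V]
    (ρ : MU2 →ₐ[K] Module.End K V) :
    iSupIndep (fun p : K × K => wtSpace ρ p.1 p.2) ∧
    (⨆ p : K × K, wtSpace ρ p.1 p.2) = ⊤ ∧
    (∀ lam eps : K, wtSpace ρ lam eps ≠ ⊥ →
      (eps = 0 ∨ eps = 1) ∧ ∃ a : ℤ, lam = vv ^ a ∨ lam = -vv ^ a) := by
  have hq := vv_sq_pow_ne_one
  have hρ := isQuantumTriple_of_rep ρ
  have hll : ∀ x, ρ Ll (ρ Ll x) = ρ Ll x := fun x =>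
    DFunLike.congr_fun (show ρ Ll * ρ Ll = ρ Ll by rw [← map_mul, Ll_mul_Ll]) x
  have hkl : Commute (ρ Kk) (ρ Ll) := by
    rw [Commute, SemiconjBy, ← map_mul, ← map_mul, Kk_mul_Ll]
  have mem_wt : ∀ {lam eps : K} {x : V},
      x ∈ wtSpace ρ lam eps ↔ ρ Kk x = lam • x ∧ ρ Ll x = eps • x := by
    intro lam eps x
    simp [wtSpace, sub_eq_zero]
  refine ⟨?_, ?_, ?_⟩
  · refine (iSupIndep_inf_eigenspace hkl).mono fun p x hx => ?_
    obtain ⟨h1, h2⟩ := mem_wt.1 hx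
    exact ⟨Module.End.mem_eigenspace_iff.2 h1, Module.End.mem_eigenspace_iff.2 h2⟩
  · rw [eq_top_iff, ← hρ.eigenspan_eq_top vv_ne_zero hq, eigenspan, Submodule.span_le]
    rintro x ⟨lam, -, hx⟩
    have h1 : ρ Ll x ∈ wtSpace ρ lam 1 := by
      refine mem_wt.2 ⟨?_, by rw [hll, one_smul]⟩
      rw [← Module.End.mul_apply, hkl.eq, Module.End.mul_apply, hx, map_smul]
    have h0 : x - ρ Ll x ∈ wtSpace ρ lam 0 := by
      refine mem_wt.2 ⟨?_, by rw [map_sub, hll, sub_self, zero_smul]⟩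
      rw [map_sub, (mem_wt.1 h1).1, hx, smul_sub]
    rw [← sub_add_cancel x (ρ Ll x)]
    exact add_mem (Submodule.mem_iSup_of_mem (lam, 0) h0) (Submodule.mem_iSup_of_mem (lam, 1) h1)
  · intro lam eps hne
    obtain ⟨x, hx, hx0⟩ := Submodule.exists_mem_ne_zero_of_ne_bot hne
    obtain ⟨h1, h2⟩ := mem_wt.1 hx
    constructor
    · have h := hll x
      rw [h2, map_smul, h2, smul_smul] at h
      exact IsIdempotentElem.iff_eq_zero_or_one.1 (smul_left_injective K hx0 h)
    · obtain ⟨b, hb⟩ := hρ.eigenvalue_sq vv_ne_zero hq h1 hx0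
      refine ⟨b, sq_eq_sq_iff_eq_or_eq_neg.1 ?_⟩
      rw [hb, ← zpow_natCast, ← zpow_natCast, ← zpow_mul, ← zpow_mul, mul_comm]

end

end MirabolicSL2
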